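/- Let t_γ := 1 − R Σ_{i=1}^∞ λ_{i+1} ρ^{i−1}. If t > t_γ, then the set E_γ(t) is at most countable. -/

import Mathlib

open MeasureTheory Filter Set Topology ENNReal

namespace HomogeneousCantorDensity

noncomputable def R (N : ℕ) (ρ : ℝ) : ℝ := (1 - ρ) / ((N : ℝ) - 1)

noncomputable def f (N : ℕ) (ρ : ℝ) (i : ℕ) (x : ℝ) : ℝ := ρ * x + (i : ℝ) * R N ρ

noncomputable def piMap (N : ℕ) (ρ : ℝ) (d : ℕ → ℕ) : ℝ :=
  R N ρ * ∑' i : ℕ, (d i : ℝ) * ρ ^ i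

def cantorE (N : ℕ) (ρ : ℝ) : Set ℝ :=
  {x | ∃ d : ℕ → ℕ, (∀ i, d i < N) ∧ x = piMap N ρ d}

/-- `μ = ∑_{i=0}^{N-1} (1/N) μ ∘ f_i⁻¹`. -/
def IsSelfSimilar (N : ℕ) (ρ : ℝ) (μ : Measure ℝ) : Prop :=
  μ = ∑ i ∈ Finset.range N, (N : ℝ≥0∞)⁻¹ • μ.map (f N ρ i)

/-- `T^n x` for `x = piMap N ρ d`. -/
noncomputable def Tn (N : ℕ) (ρ : ℝ) (d : ℕ → ℕ) (n : ℕ) : ℝ :=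
  piMap N ρ (fun i => d (n + i))

/-- pointwise lower `s`-density of `μ` at `x`. -/
noncomputable def lowerDensity (μ : Measure ℝ) (s x : ℝ) : ℝ :=
  liminf (fun r : ℝ => (μ (Ioo (x - r) (x + r))).toReal / (2 * r) ^ s) (𝓝[>] 0)

/-- pointwise upper `s`-density of `μ` at `x`. -/
noncomputable def upperDensity (μ : Measure ℝ) (s x : ℝ) : ℝ :=
  limsup (fun r : ℝ => (μ (Ioo (x - r) (x + r))).toReal / (2 * r) ^ s) (𝓝[>] 0)

/-- reflection of a sequence: `(c_i) ↦ (N-1-c_i)`. -/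
def reflSeq (N : ℕ) (a : ℕ → ℕ) : ℕ → ℕ := fun i => N - 1 - a i

/-- lexicographic order `a ≼ b` on sequences. -/
def lexLE (a b : ℕ → ℕ) : Prop :=
  a = b ∨ ∃ n : ℕ, (∀ i < n, a i = b i) ∧ a n < b n

/-- the shifted sequence `d_{n+1} d_{n+2} …` (0-indexed). -/
def shiftSeq (d : ℕ → ℕ) (n : ℕ) : ℕ → ℕ := fun i => d (n + i)

/-- `γ_{n+1}(x)` for `x = piMap N ρ d` (`d` 0-indexed, so `d n` is the digit `d_{n+1}`). -/
noncomputable def gam (N : ℕ) (ρ : ℝ) (d : ℕ → ℕ) (n : ℕ) : ℝ :=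
  if d n = 0 then Tn N ρ d (n + 1)
  else if d n = N - 1 then 1 - Tn N ρ d (n + 1)
  else max (Tn N ρ d (n + 1)) (1 - Tn N ρ d (n + 1))

/-- `E_γ(t) = {x ∈ E : liminf_n γ_n(x) ≥ t}`. -/
def Egamma (N : ℕ) (ρ : ℝ) (t : ℝ) : Set ℝ :=
  {x | ∃ d : ℕ → ℕ, (∀ i, d i < N) ∧ x = piMap N ρ d ∧
    t ≤ liminf (fun n => gam N ρ d n) atTop}

/-- the symbolic set `E'_γ(t)`, described via the coding `α` of the smallest element of `E`
that is `≥ t`. -/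
def Egamma' (N : ℕ) (α : ℕ → ℕ) : Set (ℕ → ℕ) :=
  {d | (∀ i, d i < N) ∧ ∀ n : ℕ,
    (d n = 0 → lexLE α (shiftSeq d (n + 1))) ∧
    (1 ≤ d n → d n ≤ N - 2 →
      lexLE α (shiftSeq d (n + 1)) ∨ lexLE (shiftSeq d (n + 1)) (reflSeq N α)) ∧
    (d n = N - 1 → lexLE (shiftSeq d (n + 1)) (reflSeq N α))}

/-- `u < v` lexicographically, with the first difference before position `K`. -/
def blt (K : ℕ) (u v : ℕ → ℕ) : Prop := ∃ k < K, (∀ i < k, u i = v i) ∧ u k < v k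

lemma blt_asymm_refl {N : ℕ} {K : ℕ} {x l : ℕ → ℕ} (hl : ∀ i, l i < N)
    (h : blt K (reflSeq N x) l) {k : ℕ} (hk : k < K) (he : ∀ i < k, x i = N - 1 - l i)
    (hlt : x k < N - 1 - l k) : False := by
  obtain ⟨j, hj, he', hlt'⟩ := h
  simp only [reflSeq] at he' hlt'
  have h1 := hl j
  have h2 := hl k
  rcases lt_trichotomy j k with h | h | h
  · have := he j h; omega
  · subst h; omega
  · have := he' k h; omega

lemma reflSeq_reflSeq {N : ℕ} {d : ℕ → ℕ} (hd : ∀ i, d i < N) :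
    reflSeq N (reflSeq N d) = d := by
  funext i; have := hd i; simp only [reflSeq]; omega

lemma reflSeq_shift (N : ℕ) (d : ℕ → ℕ) (n : ℕ) :
    reflSeq N (shiftSeq d n) = shiftSeq (reflSeq N d) n := rfl

lemma reflSeq_lt {N : ℕ} (hN : 2 ≤ N) (d : ℕ → ℕ) (i : ℕ) : reflSeq N d i < N := by
  simp only [reflSeq]; omega

/-- one step: a block equal to `l` of length `2^m` is followed by its reflection. -/
lemma step {N : ℕ} {l : ℕ → ℕ} (hl : ∀ i, l i < N) (m : ℕ)
    (h2 : ∀ i, i + 1 < 2 ^ m → l (2 ^ m + i) = N - 1 - l i)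
    (h3 : ∀ i, i + 1 = 2 ^ m → l (2 ^ m + i) = N - l i)
    {d : ℕ → ℕ} (n : ℕ)
    (hC : blt (2 ^ (m + 1)) (shiftSeq d n) l)
    (hC' : blt (2 ^ (m + 1)) (reflSeq N (shiftSeq d (n + 2 ^ m))) l)
    (he : ∀ i < 2 ^ m, d (n + i) = l i) :
    ∀ i < 2 ^ m, d (n + 2 ^ m + i) = N - 1 - l i := by
  obtain ⟨k, hk, hek, hlt⟩ := hC
  simp only [shiftSeq] at hek hlt
  have hpow : 2 ^ (m + 1) = 2 ^ m + 2 ^ m := by ring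
  have hkm : 2 ^ m ≤ k := by
    by_contra h
    have := he k (by omega)
    omega
  obtain ⟨j, rfl⟩ := Nat.exists_eq_add_of_le hkm
  have hagree : ∀ i < j, d (n + 2 ^ m + i) = N - 1 - l i := by
    intro i hi
    have := hek (2 ^ m + i) (by omega)
    rw [h2 i (by omega), ← add_assoc] at this
    exact this
  rw [← add_assoc] at hlt
  by_cases hj : j + 1 = 2 ^ m
  · rw [h3 j hj] at hlt
    have hjN := hl j
    rcases Nat.lt_or_ge (d (n + 2 ^ m + j)) (N - 1 - l j) with h | h
    · exact (blt_asymm_refl hl hC' (k := j) (by omega) hagree h).elim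
    · intro i hi
      rcases Nat.lt_or_ge i j with h' | h'
      · exact hagree i h'
      · have : i = j := by omega
        subst this; omega
  · rw [h2 j (by omega)] at hlt
    exact (blt_asymm_refl hl hC' (k := j) (by omega) hagree hlt).elim

lemma step' {N : ℕ} (hN : 2 ≤ N) {l : ℕ → ℕ} (hl : ∀ i, l i < N) (m : ℕ)
    (h2 : ∀ i, i + 1 < 2 ^ m → l (2 ^ m + i) = N - 1 - l i)
    (h3 : ∀ i, i + 1 = 2 ^ m → l (2 ^ m + i) = N - l i)
    {d : ℕ → ℕ} (hd : ∀ i, d i < N) (n : ℕ)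
    (hC : blt (2 ^ (m + 1)) (reflSeq N (shiftSeq d n)) l)
    (hC' : blt (2 ^ (m + 1)) (shiftSeq d (n + 2 ^ m)) l)
    (he : ∀ i < 2 ^ m, d (n + i) = N - 1 - l i) :
    ∀ i < 2 ^ m, d (n + 2 ^ m + i) = l i := by
  have := step (d := reflSeq N d) hl m h2 h3 n hC
    (by rw [← reflSeq_shift, reflSeq_reflSeq (d := shiftSeq d (n + 2 ^ m)) (fun i => hd _)]; exact hC')
    (by intro i hi; have := he i hi; have := hl i; simp only [reflSeq]; omega)
  intro i hi
  have h := this i hi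
  have := hl i
  have := hd (n + 2 ^ m + i)
  simp only [reflSeq] at h
  omega

lemma periodic_of_agree {N : ℕ} (hN : 2 ≤ N) {l : ℕ → ℕ} (hl : ∀ i, l i < N) (m : ℕ)
    (h2 : ∀ i, i + 1 < 2 ^ m → l (2 ^ m + i) = N - 1 - l i)
    (h3 : ∀ i, i + 1 = 2 ^ m → l (2 ^ m + i) = N - l i)
    {d : ℕ → ℕ} (hd : ∀ i, d i < N) (n0 : ℕ)
    (hC : ∀ n ≥ n0, blt (2 ^ (m + 1)) (shiftSeq d n) l)
    (hC' : ∀ n ≥ n0, blt (2 ^ (m + 1)) (reflSeq N (shiftSeq d n)) l)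
    (n : ℕ) (hn : n0 ≤ n)
    (he : ∀ i < 2 ^ m, d (n + i) = l i) :
    ∀ k ≥ n, d (k + 2 ^ (m + 1)) = d k := by
  have hpow : 2 ^ (m + 1) = 2 ^ m + 2 ^ m := by ring
  have hpos : 0 < 2 ^ m := by positivity
  have key : ∀ j, ∀ i < 2 ^ m, d (n + j * 2 ^ (m + 1) + i) = l i := by
    intro j
    induction j with
    | zero => simpa using he
    | succ j ih =>
      have a := step hl m h2 h3 (n + j * 2 ^ (m + 1)) (hC _ (by omega)) (hC' _ (by omega)) ih
      have b := step' hN hl m h2 h3 hd (n + j * 2 ^ (m + 1) + 2 ^ m)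
        (hC' _ (by omega)) (hC _ (by omega)) a
      intro i hi
      rw [← b i hi]; congr 1; rw [add_mul, hpow]; ring
  have key2 : ∀ j, ∀ i < 2 ^ m, d (n + j * 2 ^ (m + 1) + 2 ^ m + i) = N - 1 - l i := fun j =>
    step hl m h2 h3 (n + j * 2 ^ (m + 1)) (hC _ (by omega)) (hC' _ (by omega)) (key j)
  intro k hk
  obtain ⟨q, rfl⟩ := Nat.exists_eq_add_of_le hk
  have hr := Nat.mod_lt q (show 0 < 2 ^ (m + 1) by positivity)
  have hq := Nat.div_add_mod' q (2 ^ (m + 1))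
  set j := q / 2 ^ (m + 1)
  set r := q % 2 ^ (m + 1)
  have hj : (j + 1) * 2 ^ (m + 1) = j * 2 ^ (m + 1) + 2 ^ (m + 1) := by ring
  rcases Nat.lt_or_ge r (2 ^ m) with h | h
  · have a := key j r h
    have b := key (j + 1) r h
    rw [show n + q + 2 ^ (m + 1) = n + (j + 1) * 2 ^ (m + 1) + r by omega, b,
      show n + q = n + j * 2 ^ (m + 1) + r by omega, a]
  · have a := key2 j (r - 2 ^ m) (by omega)
    have b := key2 (j + 1) (r - 2 ^ m) (by omega)
    rw [show n + q + 2 ^ (m + 1) = n + (j + 1) * 2 ^ (m + 1) + 2 ^ m + (r - 2 ^ m) by omega, b,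
      show n + q = n + j * 2 ^ (m + 1) + 2 ^ m + (r - 2 ^ m) by omega, a]

/-- eventually periodic sequences -/
def EvPer (d : ℕ → ℕ) : Prop := ∃ n p : ℕ, 0 < p ∧ ∀ k ≥ n, d (k + p) = d k

lemma blt_cut {m : ℕ} {x l : ℕ → ℕ} (h : blt (2 ^ (m + 1)) x l)
    (hne : ¬ ∀ i < 2 ^ m, x i = l i) : blt (2 ^ m) x l := by
  obtain ⟨k, hk, he, hlt⟩ := h
  refine ⟨k, ?_, he, hlt⟩
  by_contra hk'
  exact hne fun i hi => he i (by omega)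

lemma evPer_of_blocks {N : ℕ} (hN : 2 ≤ N) {l : ℕ → ℕ} (hl : ∀ i, l i < N)
    (l0 : l 0 = N - 1) (l1 : l 1 = 1) (l2 : l 2 = 0)
    (h2 : ∀ m i, i + 1 < 2 ^ m → l (2 ^ m + i) = N - 1 - l i)
    (h3 : ∀ m i, i + 1 = 2 ^ m → l (2 ^ m + i) = N - l i)
    {d : ℕ → ℕ} (hd : ∀ i, d i < N) (n0 K : ℕ)
    (hmid : ∀ n ≥ n0, d n ≠ 0 → d n ≠ N - 1 → blt K (shiftSeq d (n + 1)) (shiftSeq l 1) ∨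
      blt K (reflSeq N (shiftSeq d (n + 1))) (shiftSeq l 1)) (m : ℕ)
    (hC : ∀ n ≥ n0, blt (2 ^ m) (shiftSeq d n) l)
    (hC' : ∀ n ≥ n0, blt (2 ^ m) (reflSeq N (shiftSeq d n)) l) : EvPer d := by
  induction m with
  | zero =>
    exfalso
    have hm : ∀ n ≥ n0, d n ≠ 0 ∧ d n ≠ N - 1 := by
      intro n hn
      obtain ⟨k, hk, -, h⟩ := hC n hn
      obtain ⟨k', hk', -, h'⟩ := hC' n hn
      obtain rfl : k = 0 := by simpa using hk
      obtain rfl : k' = 0 := by simpa using hk'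
      simp only [shiftSeq, reflSeq, l0, add_zero] at h h'
      omega
    have a0 := hm n0 le_rfl
    have a1 := hm (n0 + 1) (by omega)
    have a2 := hm (n0 + 1 + 1) (by omega)
    have b1 := hd (n0 + 1)
    have b2 := hd (n0 + 1 + 1)
    rcases hmid n0 le_rfl a0.1 a0.2 with ⟨k, -, he, hlt⟩ | ⟨k, -, he, hlt⟩
    all_goals
      simp only [shiftSeq, reflSeq] at he hlt
      rcases k with _ | _ | k
      · simp only [add_zero, l1] at hlt
        omega
      · simp only [zero_add, show 1 + 1 = 2 from rfl, l2] at hlt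
        omega
      · have := he 1 (by omega)
        simp only [show 1 + 1 = 2 from rfl, l2] at this
        omega
  | succ m ih =>
    by_cases hA : ∃ n ≥ n0, ∀ i < 2 ^ m, d (n + i) = l i
    · obtain ⟨n, hn, he⟩ := hA
      exact ⟨n, _, by positivity,
        periodic_of_agree hN hl m (h2 m) (h3 m) hd n0 hC hC' n hn he⟩
    by_cases hB : ∃ n ≥ n0, ∀ i < 2 ^ m, reflSeq N d (n + i) = l i
    · obtain ⟨n, hn, he⟩ := hB
      have he' : ∀ i < 2 ^ m, d (n + i) = N - 1 - l i := by
        intro i hi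
        have := he i hi
        have := hd (n + i)
        simp only [reflSeq] at *
        omega
      exact ⟨n + 2 ^ m, _, by positivity,
        periodic_of_agree hN hl m (h2 m) (h3 m) hd n0 hC hC' (n + 2 ^ m) (le_add_right hn)
          (step' hN hl m (h2 m) (h3 m) hd n (hC' n hn) (hC _ (le_add_right hn)) he')⟩
    · push Not at hA hB
      refine ih (fun n hn => blt_cut (hC n hn) ?_) (fun n hn => blt_cut (hC' n hn) ?_)
      · obtain ⟨i, hi, hne⟩ := hA n hn
        exact fun h => hne (h i hi)
      · obtain ⟨i, hi, hne⟩ := hB n hn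
        exact fun h => hne (h i hi)

lemma evPer_countable : {d : ℕ → ℕ | EvPer d}.Countable := by
  have : {d : ℕ → ℕ | EvPer d} =
      ⋃ n : ℕ, ⋃ p : ℕ, {d | 0 < p ∧ ∀ k ≥ n, d (k + p) = d k} := by
    ext d; simp [EvPer]
  rw [this]
  refine countable_iUnion fun n => countable_iUnion fun p => ?_
  refine Set.MapsTo.countable_of_injOn (f := fun d => fun i : Fin (n + p) => d i)
    (t := Set.univ) (fun _ _ => Set.mem_univ _) ?_ (Set.to_countable _)
  rintro d ⟨hp, hd⟩ e ⟨-, he⟩ h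
  funext k
  induction k using Nat.strong_induction_on with
  | _ k ih =>
    rcases Nat.lt_or_ge k (n + p) with hk | hk
    · exact congrFun h ⟨k, hk⟩
    · have a := hd (k - p) (by omega)
      have b := he (k - p) (by omega)
      rw [Nat.sub_add_cancel (by omega)] at a b
      rw [a, b, ih (k - p) (by omega)]

section estimates

variable {N : ℕ} {ρ : ℝ}

lemma summ (hρ0 : 0 < ρ) (hρ1 : ρ < 1) {u : ℕ → ℕ} (hu : ∀ i, u i < N) :
    Summable fun i => (u i : ℝ) * ρ ^ i := by
  refine Summable.of_nonneg_of_le (fun i => by positivity) (fun i => ?_)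
    ((summable_geometric_of_lt_one hρ0.le hρ1).mul_left (N : ℝ))
  have : (u i : ℝ) ≤ N := by exact_mod_cast (hu i).le
  gcongr

lemma piMap_refl (hN : 2 ≤ N) (hρ0 : 0 < ρ) (hρ1 : ρ < 1) {u : ℕ → ℕ} (hu : ∀ i, u i < N) :
    piMap N ρ (reflSeq N u) = 1 - piMap N ρ u := by
  have hN' : (2 : ℝ) ≤ N := by exact_mod_cast hN
  have h1 : (fun i => ((reflSeq N u i : ℕ) : ℝ) * ρ ^ i) =
      fun i => ((N : ℝ) - 1) * ρ ^ i - (u i : ℝ) * ρ ^ i := by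
    funext i
    have := hu i
    have h : ((reflSeq N u i : ℕ) : ℝ) = (N : ℝ) - 1 - u i := by
      simp only [reflSeq]
      rw [Nat.cast_sub (by omega), Nat.cast_sub (by omega)]; simp
    rw [h]; ring
  unfold piMap
  rw [h1, Summable.tsum_sub ((summable_geometric_of_lt_one hρ0.le hρ1).mul_left _)
    (summ hρ0 hρ1 hu), tsum_mul_left, tsum_geometric_of_lt_one hρ0.le hρ1, R]
  have : (N : ℝ) - 1 ≠ 0 := by linarith
  have : 1 - ρ ≠ 0 := by linarith
  field_simp

lemma R_pos (hN : 2 ≤ N) (hρ1 : ρ < 1) : 0 < R N ρ := by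
  have hN' : (2 : ℝ) ≤ N := by exact_mod_cast hN
  unfold R
  apply div_pos <;> linarith

lemma piMap_nonneg (hN : 2 ≤ N) (hρ0 : 0 < ρ) (hρ1 : ρ < 1) (u : ℕ → ℕ) :
    0 ≤ piMap N ρ u :=
  mul_nonneg (R_pos hN hρ1).le (tsum_nonneg fun i => by positivity)

lemma piMap_le_one (hN : 2 ≤ N) (hρ0 : 0 < ρ) (hρ1 : ρ < 1) {u : ℕ → ℕ} (hu : ∀ i, u i < N) :
    piMap N ρ u ≤ 1 := by
  have := piMap_refl hN hρ0 hρ1 hu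
  have := piMap_nonneg hN hρ0 hρ1 (reflSeq N u)
  linarith

lemma piMap_split (hρ0 : 0 < ρ) (hρ1 : ρ < 1) {u : ℕ → ℕ} (hu : ∀ i, u i < N) (k : ℕ) :
    piMap N ρ u = R N ρ * ∑ i ∈ Finset.range k, (u i : ℝ) * ρ ^ i
      + ρ ^ k * piMap N ρ (shiftSeq u k) := by
  unfold piMap
  rw [← (summ hρ0 hρ1 hu).sum_add_tsum_nat_add k]
  have : (fun i => (u (i + k) : ℝ) * ρ ^ (i + k)) =
      fun i => ρ ^ k * ((shiftSeq u k i : ℝ) * ρ ^ i) := by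
    funext i; simp only [shiftSeq, add_comm k i, pow_add]; ring
  rw [this, tsum_mul_left]; ring

lemma piMap_le_of_lex (hN : 2 ≤ N) (hρ0 : 0 < ρ) (hρ1 : ρ < 1) (hR : ρ ≤ R N ρ)
    {u v : ℕ → ℕ} (hu : ∀ i, u i < N) (hv : ∀ i, v i < N) (k : ℕ)
    (he : ∀ i < k, u i = v i) (hlt : u k < v k) : piMap N ρ u ≤ piMap N ρ v := by
  rw [piMap_split hρ0 hρ1 hu k, piMap_split hρ0 hρ1 hv k]
  have hs : ∑ i ∈ Finset.range k, (u i : ℝ) * ρ ^ i = ∑ i ∈ Finset.range k, (v i : ℝ) * ρ ^ i :=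
    Finset.sum_congr rfl fun i hi => by rw [he i (Finset.mem_range.1 hi)]
  rw [hs]
  have hu' : ∀ i, shiftSeq u k i < N := fun i => hu _
  have hv' : ∀ i, shiftSeq v k i < N := fun i => hv _
  have : piMap N ρ (shiftSeq u k) ≤ piMap N ρ (shiftSeq v k) := by
    rw [piMap_split hρ0 hρ1 hu' 1, piMap_split hρ0 hρ1 hv' 1]
    have a := piMap_le_one hN hρ0 hρ1 (u := shiftSeq (shiftSeq u k) 1) (fun i => hu _)
    have b := piMap_nonneg hN hρ0 hρ1 (shiftSeq (shiftSeq v k) 1)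
    have c := R_pos hN hρ1
    have e : (u k : ℝ) + 1 ≤ v k := by exact_mod_cast hlt
    simp only [Finset.range_one, Finset.sum_singleton, pow_zero, mul_one, pow_one, shiftSeq,
      add_zero] at *
    nlinarith
  gcongr

lemma blt_of_piMap (hN : 2 ≤ N) (hρ0 : 0 < ρ) (hρ1 : ρ < 1) (hR : ρ ≤ R N ρ)
    {x a : ℕ → ℕ} (hx : ∀ i, x i < N) (ha : ∀ i, a i < N) (K : ℕ) {δ : ℝ} (hδ : 0 < δ)
    (hK : ρ ^ K ≤ δ) (h : piMap N ρ x < piMap N ρ a - δ) : blt K x a := by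
  classical
  by_cases hne : ∃ k, x k ≠ a k ∧ k < K
  · have hs := Nat.find_spec hne
    have hmin : ∀ i < Nat.find hne, x i = a i := by
      intro i hi
      by_contra hc
      exact Nat.find_min hne hi ⟨hc, by omega⟩
    refine ⟨Nat.find hne, hs.2, hmin, ?_⟩
    by_contra hlt
    have := piMap_le_of_lex hN hρ0 hρ1 hR ha hx (Nat.find hne) (fun i hi => (hmin i hi).symm)
      (lt_of_le_of_ne (not_lt.1 hlt) hs.1.symm)
    linarith
  · exfalso
    push Not at hne
    have he : ∀ i < K, x i = a i := fun i hi => by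
      by_contra hc
      exact absurd (hne i hc) (by omega)
    rw [piMap_split hρ0 hρ1 hx K, piMap_split hρ0 hρ1 ha K] at h
    have hs : ∑ i ∈ Finset.range K, (x i : ℝ) * ρ ^ i
        = ∑ i ∈ Finset.range K, (a i : ℝ) * ρ ^ i :=
      Finset.sum_congr rfl fun i hi => by rw [he i (Finset.mem_range.1 hi)]
    rw [hs] at h
    have a1 := piMap_le_one hN hρ0 hρ1 (u := shiftSeq a K) (fun i => ha _)
    have b1 := piMap_nonneg hN hρ0 hρ1 (shiftSeq x K)
    have hp : 0 < ρ ^ K := by positivity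
    nlinarith

end estimates

lemma lam_bound {N : ℕ} (hN : 2 ≤ N) {lam : ℕ → ℕ} (hlam1 : lam 1 = N - 1)
    (hlam2 : ∀ n j : ℕ, 1 ≤ j → j < 2 ^ n → lam (2 ^ n + j) = N - 1 - lam j)
    (hlam3 : ∀ n : ℕ, lam (2 ^ (n + 1)) = N - lam (2 ^ n)) (i : ℕ) : lam (i + 1) < N := by
  have hpow : ∀ n, 1 ≤ lam (2 ^ n) ∧ lam (2 ^ n) < N := by
    intro n
    induction n with
    | zero => rw [pow_zero, hlam1]; omega
    | succ n ih => rw [hlam3]; omega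
  set n := Nat.log 2 (i + 1)
  have h1 : 2 ^ n ≤ i + 1 := Nat.pow_log_le_self 2 (by omega)
  have h2 : i + 1 < 2 ^ (n + 1) := Nat.lt_pow_succ_log_self (by norm_num) _
  rcases h1.eq_or_lt with h | h
  · rw [← h]; exact (hpow n).2
  · obtain ⟨j, hj⟩ := Nat.exists_eq_add_of_lt h
    rw [pow_succ] at h2
    rw [hj, add_assoc, hlam2 n (j + 1) (by omega) (by omega)]
    omega

lemma blt_cons {N : ℕ} {K : ℕ} {x l : ℕ → ℕ} (hx : ∀ i, x i < N) (l0 : l 0 = N - 1)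
    (h : x 0 = N - 1 → blt K (shiftSeq x 1) (shiftSeq l 1)) : blt (K + 1) x l := by
  by_cases h0 : x 0 = N - 1
  · obtain ⟨k, hk, he, hlt⟩ := h h0
    refine ⟨k + 1, by omega, ?_, by simpa [shiftSeq, add_comm] using hlt⟩
    rintro (_ | i) hi
    · rw [h0, l0]
    · simpa [shiftSeq, add_comm] using he i (by omega)
  · refine ⟨0, by omega, by simp, ?_⟩
    have := hx 0
    omega


/-- Lemma 3.5: if `t > t_γ := 1 - R Σ_{i≥1} λ_{i+1} ρ^{i-1}`, then `E_γ(t)` is countable. -/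
theorem Egamma_countable (N : ℕ) (hN : 2 ≤ N) (ρ : ℝ) (hρ0 : 0 < ρ)
    (hρ1 : ρ ≤ 1 / (N : ℝ) ^ 2)
    (lam : ℕ → ℕ) (hlam1 : lam 1 = N - 1)
    (hlam2 : ∀ n j : ℕ, 1 ≤ j → j < 2 ^ n → lam (2 ^ n + j) = N - 1 - lam j)
    (hlam3 : ∀ n : ℕ, lam (2 ^ (n + 1)) = N - lam (2 ^ n))
    (t : ℝ) (ht : 1 - R N ρ * ∑' i : ℕ, (lam (i + 2) : ℝ) * ρ ^ i < t) :
    (Egamma N ρ t).Countable := by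
  have hN' : (2 : ℝ) ≤ N := by exact_mod_cast hN
  have hρN : ρ * N ^ 2 ≤ 1 := by
    rwa [le_div_iff₀ (by positivity)] at hρ1
  have hρlt : ρ < 1 := by nlinarith
  have hR : ρ ≤ R N ρ := by
    unfold R
    rw [le_div_iff₀ (by linarith)]
    nlinarith [mul_pos hρ0 (show (0 : ℝ) < N by linarith)]
  have hlb := lam_bound hN hlam1 hlam2 hlam3
  have hlam22 : lam 2 = 1 := by
    have := hlam3 0
    simp only [zero_add, pow_one, pow_zero, hlam1] at this
    omega
  have hlam33 : lam 3 = 0 := by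
    have := hlam2 1 1 le_rfl (by norm_num)
    simpa [hlam1] using this
  set l : ℕ → ℕ := fun i => lam (i + 1) with hldef
  have h2 : ∀ m i, i + 1 < 2 ^ m → l (2 ^ m + i) = N - 1 - l i := fun m i hi =>
    hlam2 m (i + 1) (by omega) hi
  have h3 : ∀ m i, i + 1 = 2 ^ m → l (2 ^ m + i) = N - l i := by
    intro m i hi
    have := hlam3 m
    simp only [hldef]
    rw [show 2 ^ m + i + 1 = 2 ^ (m + 1) by rw [pow_succ]; omega, hi]
    exact this
  have hπ : R N ρ * ∑' i : ℕ, (lam (i + 2) : ℝ) * ρ ^ i = piMap N ρ (shiftSeq l 1) := by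
    unfold piMap
    congr 2
    funext i
    simp only [shiftSeq, hldef]
    rw [show 1 + i + 1 = i + 2 by omega]
  rw [hπ] at ht
  obtain ⟨t', ht1, ht2⟩ := exists_between ht
  obtain ⟨K0, hK0⟩ := exists_pow_lt_of_lt_one
    (show 0 < t' - (1 - piMap N ρ (shiftSeq l 1)) by linarith) hρlt
  refine (evPer_countable.image (piMap N ρ)).mono ?_
  rintro x ⟨d, hd, rfl, hlim⟩
  refine ⟨d, ?_, rfl⟩
  have hT0 : ∀ n, 0 ≤ Tn N ρ d n := fun n => piMap_nonneg hN hρ0 hρlt _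
  have hT1 : ∀ n, Tn N ρ d n ≤ 1 := fun n => piMap_le_one hN hρ0 hρlt (fun i => hd _)
  have hbdd : IsBoundedUnder (· ≥ ·) atTop (fun n => gam N ρ d n) := by
    refine isBoundedUnder_of ⟨0, fun n => ?_⟩
    have a := hT0 (n + 1)
    have b := hT1 (n + 1)
    simp only [gam]
    split_ifs
    · exact a
    · show 0 ≤ _
      linarith
    · exact le_max_of_le_left a
  obtain ⟨n0, hn0⟩ := eventually_atTop.1 (eventually_lt_of_lt_liminf (lt_of_lt_of_le ht2 hlim) hbdd)
  have hKm : K0 < 2 ^ K0 := Nat.lt_two_pow_self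
  set K := 2 ^ K0 - 1 with hKdef
  have hK : ρ ^ K ≤ t' - (1 - piMap N ρ (shiftSeq l 1)) :=
    (pow_le_pow_of_le_one hρ0.le hρlt.le (by omega)).trans hK0.le
  have hδ : 0 < t' - (1 - piMap N ρ (shiftSeq l 1)) := by linarith
  have hal : ∀ i, shiftSeq l 1 i < N := fun i => hlb _
  have hhigh : ∀ n, t' < Tn N ρ d n → blt K (reflSeq N (shiftSeq d n)) (shiftSeq l 1) := by
    intro n hn
    refine blt_of_piMap hN hρ0 hρlt hR (reflSeq_lt hN _) hal K hδ hK ?_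
    rw [piMap_refl hN hρ0 hρlt (u := shiftSeq d n) (fun i => hd _)]
    change t' < piMap N ρ (shiftSeq d n) at hn
    linarith
  have hlow : ∀ n, t' < 1 - Tn N ρ d n → blt K (shiftSeq d n) (shiftSeq l 1) := by
    intro n hn
    refine blt_of_piMap hN hρ0 hρlt hR (x := shiftSeq d n) (fun i => hd _) hal K hδ hK ?_
    change t' < 1 - piMap N ρ (shiftSeq d n) at hn
    linarith
  have hsh : ∀ n, shiftSeq (shiftSeq d n) 1 = shiftSeq d (n + 1) := by
    intro n; funext i; simp only [shiftSeq, add_assoc]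
  have hN10 : N - 1 ≠ 0 := by omega
  refine evPer_of_blocks hN hlb hlam1 hlam22 hlam33 h2 h3 hd n0 K ?_ K0 ?_ ?_
  · intro n hn hne0 hne1
    have := hn0 n hn
    simp only [gam, hne0, hne1, if_false] at this
    rcases lt_max_iff.1 this with h | h
    · exact Or.inr (hhigh _ h)
    · exact Or.inl (hlow _ h)
  · intro n hn
    have hb : blt (K + 1) (shiftSeq d n) l := by
      refine blt_cons (fun i => hd _) hlam1 fun h0 => ?_
      rw [hsh]
      have hg := hn0 n hn
      have h0' : d n = N - 1 := h0
      simp only [gam, h0', hN10, if_false, if_true] at hg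
      exact hlow _ hg
    rwa [show K + 1 = 2 ^ K0 by omega] at hb
  · intro n hn
    have hb : blt (K + 1) (reflSeq N (shiftSeq d n)) l := by
      refine blt_cons (reflSeq_lt hN _) hlam1 fun h0 => ?_
      rw [show shiftSeq (reflSeq N (shiftSeq d n)) 1 = reflSeq N (shiftSeq (shiftSeq d n) 1)
        from rfl, hsh]
      have hg := hn0 n hn
      have h0' : d n = 0 := by
        have := hd n
        simp only [reflSeq, shiftSeq, add_zero] at h0
        omega
      simp only [gam, h0', if_true] at hg
      exact hhigh _ hg
    rwa [show K + 1 = 2 ^ K0 by omega] at hb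

end HomogeneousCantorDensity
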